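/- Let J ⊆ I, i ∈ I and w ∈ W. Then exactly one of s_i w ≤^J w and w ≤^J s_i w holds. Moreover, s_i w ≤^J w if and only if either (w^{-1} s_i w ∈ W_J and ℓ(s_i w) = ℓ(w) + 1) or (w^{-1} s_i w ∉ W_J and ℓ(s_i w) = ℓ(w) − 1). -/

import Mathlib

/-!
Common definitions: Bruhat order, standard parabolic subgroups, minimal coset
representatives, the J-Bruhat (twisted) order and J-length, chains and
EL-labeling machinery, for a Coxeter system `cs : CoxeterSystem M W`.
-/

open scoped Classical

namespace TwistedTP

/-- A chain (list) realizing consecutive `r`-steps starting at `a` and ending at `b`. -/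
def IsChainFrom {α : Type*} (r : α → α → Prop) (c : List α) (a b : α) : Prop :=
  c.head? = some a ∧ c.getLast? = some b ∧ c.Chain' r

/-- The word of labels attached to the consecutive pairs of a list.
For a list `z₀ :: z₁ :: ⋯` (written from top to bottom in a descending chain),
the entries are `lab z₁ z₀, lab z₂ z₁, …`, i.e. `lab` is applied to each
covering pair `(lower, upper)`. -/
def labelWord {α Λ : Type*} (lab : α → α → Λ) : List α → List Λ
  | a :: b :: rest => lab b a :: labelWord lab (b :: rest)
  | _ => []

variable {B : Type*} {W : Type*} [Group W] {M : CoxeterMatrix B}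
variable (cs : CoxeterSystem M W)

/-- The (strong) Bruhat order on `W`: `v ≤ w` iff some reduced word for `w`
has a sublist whose product is `v`. -/
def bruhatLE (v w : W) : Prop :=
  ∃ ω : List B, cs.IsReduced ω ∧ cs.wordProd ω = w ∧
    ∃ ω' : List B, ω'.Sublist ω ∧ cs.wordProd ω' = v

def bruhatLT (v w : W) : Prop := bruhatLE cs v w ∧ v ≠ w

def bruhatCovBy (v w : W) : Prop :=
  bruhatLT cs v w ∧ ¬ ∃ z, bruhatLT cs v z ∧ bruhatLT cs z w

/-- The standard parabolic subgroup `W_J`. -/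
def parabolic (J : Set B) : Subgroup W := Subgroup.closure (cs.simple '' J)

lemma exists_minRep (J : Set B) (w : W) :
    ∃ u : W, u⁻¹ * w ∈ parabolic cs J ∧
      ∀ x : W, x⁻¹ * w ∈ parabolic cs J → cs.length u ≤ cs.length x := by
  have hne : (cs.length '' {x : W | x⁻¹ * w ∈ parabolic cs J}).Nonempty :=
    ⟨cs.length w, w, by simpa using (parabolic cs J).one_mem, rfl⟩
  obtain ⟨n, hn, hmin⟩ := Nat.lt_wfRel.wf.has_min _ hne
  obtain ⟨u, hu, rfl⟩ := hn
  refine ⟨u, hu, fun x hx => ?_⟩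
  by_contra h
  exact hmin _ ⟨x, hx, rfl⟩ (Nat.lt_of_not_le h)

/-- The minimal-length representative `w^J` of the coset `w W_J`. -/
noncomputable def minRep (J : Set B) (w : W) : W := (exists_minRep cs J w).choose

/-- The parabolic part `w_J = (w^J)⁻¹ w ∈ W_J` of `w`. -/
noncomputable def parPart (J : Set B) (w : W) : W := (minRep cs J w)⁻¹ * w

/-- The J-Bruhat (twisted) order `≤^J` on `W`:
`v ≤^J w` iff there is `u ∈ W_J` with `v^J u ≤ w^J` and `w_J ≤ u⁻¹ v_J`. -/
def twistedLE (J : Set B) (v w : W) : Prop :=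
  ∃ u ∈ parabolic cs J,
    bruhatLE cs (minRep cs J v * u) (minRep cs J w) ∧
    bruhatLE cs (parPart cs J w) (u⁻¹ * parPart cs J v)

def twistedLT (J : Set B) (v w : W) : Prop := twistedLE cs J v w ∧ v ≠ w

def twistedCovBy (J : Set B) (v w : W) : Prop :=
  twistedLT cs J v w ∧ ¬ ∃ z, twistedLT cs J v z ∧ twistedLT cs J z w

/-- The J-length `ℓ^J(w) = ℓ(w^J) - ℓ(w_J)` (an integer). -/
noncomputable def twistedLength (J : Set B) (w : W) : ℤ :=
  (cs.length (minRep cs J w) : ℤ) - (cs.length (parPart cs J w) : ℤ)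



lemma functionEnd_one_apply {α : Type*} (x : α) : (1 : Function.End α) x = x := rfl

lemma functionEnd_mul_apply {α : Type*} (f g : Function.End α) (x : α) : (f * g) x = f (g x) := rfl

/-- The generator `s_i` acts on `W × ℤ/2` by conjugation on the first factor, changing the second
factor exactly at `s_i` itself. -/
noncomputable def signedConj (i : B) : Function.End (W × ZMod 2) := fun p =>
  (cs.simple i * p.1 * cs.simple i, p.2 + if p.1 = cs.simple i then 1 else 0)

lemma signedConj_mul_pow_apply (i j : B) (n : ℕ) (p : W × ZMod 2) :
    ((signedConj cs i * signedConj cs j) ^ n) p =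
      ((cs.simple i * cs.simple j) ^ n * p.1 * ((cs.simple i * cs.simple j) ^ n)⁻¹,
        p.2 + ∑ k ∈ Finset.range (2 * n),
          if (cs.simple i * cs.simple j) ^ k * p.1 = cs.simple j then 1 else 0) := by
  have hji : (cs.simple i * cs.simple j)⁻¹ = cs.simple j * cs.simple i := by simp
  have hconj : ∀ k : ℕ, cs.simple j * (cs.simple i * cs.simple j) ^ k =
      ((cs.simple i * cs.simple j) ^ k)⁻¹ * cs.simple j := by
    intro k
    rw [← inv_pow, hji]
    exact ((SemiconjBy.pow_right (by simp [SemiconjBy, mul_assoc]) k :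
      SemiconjBy (cs.simple j) _ ((cs.simple j * cs.simple i) ^ k))).eq
  induction n with
  | zero => simp [functionEnd_one_apply]
  | succ n ih =>
    rw [pow_succ', functionEnd_mul_apply, ih, functionEnd_mul_apply]
    set r := cs.simple i * cs.simple j with hr
    have hodd : (r ^ n * p.1 * (r ^ n)⁻¹ = cs.simple j) ↔ r ^ (2 * n) * p.1 = cs.simple j := by
      rw [mul_inv_eq_iff_eq_mul, hconj, two_mul, pow_add, mul_assoc, eq_inv_mul_iff_mul_eq]
    have heven : (cs.simple j * (r ^ n * p.1 * (r ^ n)⁻¹) * cs.simple j = cs.simple i) ↔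
        r ^ (2 * n + 1) * p.1 = cs.simple j := by
      have h₁ : (cs.simple j * (r ^ n * p.1 * (r ^ n)⁻¹) * cs.simple j = cs.simple i) ↔
          r ^ n * p.1 * (r ^ n)⁻¹ = r⁻¹ * cs.simple j := by
        constructor
        · intro h
          rw [hji, ← h]
          simp [mul_assoc]
        · intro h
          rw [h, hji]
          simp [mul_assoc]
      rw [h₁, mul_inv_eq_iff_eq_mul, mul_assoc, hconj, eq_inv_mul_iff_mul_eq,
        eq_inv_mul_iff_mul_eq]
      simp only [← mul_assoc, ← pow_succ, ← pow_add]
      rw [show n + 1 + n = 2 * n + 1 by ring]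
    simp only [signedConj, hodd, heven]
    refine Prod.ext ?_ ?_
    · simp [hr, pow_succ', mul_assoc]
    · rw [show 2 * (n + 1) = 2 * n + 1 + 1 by ring, Finset.sum_range_succ, Finset.sum_range_succ]
      simp only [add_assoc]

lemma isLiftable_signedConj : M.IsLiftable (signedConj cs) := by
  intro i j
  funext p
  rw [signedConj_mul_pow_apply, cs.simple_mul_simple_pow, two_mul, Finset.sum_range_add]
  simp only [pow_add, cs.simple_mul_simple_pow, one_mul, CharTwo.add_self_eq_zero]
  simp [functionEnd_one_apply]

/-- The action of `W` on `W × ℤ/2` extending `signedConj`. -/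
noncomputable def signedConjHom : W →* Function.End (W × ZMod 2) :=
  cs.lift ⟨signedConj cs, isLiftable_signedConj cs⟩

lemma signedConjHom_simple (i : B) : signedConjHom cs (cs.simple i) = signedConj cs i :=
  cs.lift_apply_simple (isLiftable_signedConj cs) i

lemma signedConjHom_wordProd (ω : List B) (p : W × ZMod 2) :
    signedConjHom cs (cs.wordProd ω) p =
      (cs.wordProd ω * p.1 * (cs.wordProd ω)⁻¹,
        p.2 + ((cs.rightInvSeq ω).map fun t => if p.1 = t then (1 : ZMod 2) else 0).sum) := by
  induction ω with
  | nil => simp [functionEnd_one_apply]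
  | cons i ω ih =>
    rw [cs.wordProd_cons, map_mul, functionEnd_mul_apply, ih,
      signedConjHom_simple]
    have h : (cs.wordProd ω * p.1 * (cs.wordProd ω)⁻¹ = cs.simple i) ↔
        p.1 = (cs.wordProd ω)⁻¹ * cs.simple i * cs.wordProd ω := by
      rw [mul_inv_eq_iff_eq_mul, mul_assoc, eq_inv_mul_iff_mul_eq]
    simp only [signedConj, h, CoxeterSystem.rightInvSeq, List.map_cons, List.sum_cons]
    refine Prod.ext ?_ ?_
    · simp [mul_assoc]
    · simp only [add_comm, add_left_comm]

lemma signedConjHom_snd_of_notMem {ω : List B} {t : W} (ht : t ∉ cs.rightInvSeq ω) (ε : ZMod 2) :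
    (signedConjHom cs (cs.wordProd ω) (t, ε)).2 = ε := by
  rw [signedConjHom_wordProd]
  simp only [add_eq_left]
  refine List.sum_eq_zero ?_
  simp only [List.mem_map]
  rintro _ ⟨x, hx, rfl⟩
  rw [if_neg]
  rintro rfl
  exact ht hx

/-- The exchange property: a right descent of `π ω` is a right inversion of the word `ω`. -/
lemma simple_mem_rightInvSeq {ω : List B} {j : B}
    (h : cs.IsRightDescent (cs.wordProd ω) j) : cs.simple j ∈ cs.rightInvSeq ω := by
  by_contra hmem
  have h₀ := signedConjHom_snd_of_notMem cs hmem 0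
  obtain ⟨η, hη, hηw⟩ := cs.exists_isReduced (cs.wordProd ω * cs.simple j)
  have hnot : cs.simple j ∉ cs.rightInvSeq η := by
    intro hj
    have h₁ := (cs.isRightInversion_of_mem_rightInvSeq hη hj).2
    rw [← hηw, cs.simple_mul_simple_cancel_right] at h₁
    exact lt_asymm h h₁
  have h₁ : signedConjHom cs (cs.wordProd ω) (cs.simple j, 0) =
      signedConjHom cs (cs.wordProd η) (cs.simple j, 1) := by
    conv_lhs => rw [← cs.simple_mul_simple_cancel_right (w := cs.wordProd ω) j]
    rw [hηw, map_mul, functionEnd_mul_apply, signedConjHom_simple]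
    simp [signedConj]
  rw [h₁, signedConjHom_snd_of_notMem cs hnot] at h₀
  exact one_ne_zero h₀

lemma exists_eraseIdx_of_isRightDescent {ω : List B} {j : B}
    (h : cs.IsRightDescent (cs.wordProd ω) j) :
    ∃ k < ω.length, cs.wordProd ω * cs.simple j = cs.wordProd (ω.eraseIdx k) := by
  obtain ⟨k, hk, hkj⟩ := List.getElem_of_mem (simple_mem_rightInvSeq cs h)
  refine ⟨k, by simpa using hk, ?_⟩
  rw [← cs.wordProd_mul_getD_rightInvSeq, List.getD_eq_getElem _ _ hk, hkj]

variable {cs} in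
lemma bruhatLE.length_le {v w : W} (h : bruhatLE cs v w) : cs.length v ≤ cs.length w := by
  obtain ⟨ω, hω, rfl, ω', hsub, rfl⟩ := h
  rw [hω.eq]
  exact (cs.length_wordProd_le ω').trans hsub.length_le

lemma bruhatLE_refl (w : W) : bruhatLE cs w w := by
  obtain ⟨ω, hω, rfl⟩ := cs.exists_isReduced w
  exact ⟨ω, hω, rfl, ω, List.Sublist.refl ω, rfl⟩

lemma bruhatLE_simple_mul {w : W} {i : B} (h : cs.length (cs.simple i * w) = cs.length w + 1) :
    bruhatLE cs w (cs.simple i * w) := by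
  obtain ⟨ω, hω, rfl⟩ := cs.exists_isReduced w
  refine ⟨i :: ω, ?_, cs.wordProd_cons i ω, ω, List.sublist_cons_self i ω, rfl⟩
  rw [CoxeterSystem.IsReduced, cs.wordProd_cons, h, hω.eq, List.length_cons]

lemma wordProd_mem_parabolic {J : Set B} {ω : List B} (h : ∀ j ∈ ω, j ∈ J) :
    cs.wordProd ω ∈ parabolic cs J := by
  refine Subgroup.list_prod_mem _ ?_
  simp only [List.mem_map]
  rintro _ ⟨j, hj, rfl⟩
  exact Subgroup.subset_closure ⟨j, h j hj, rfl⟩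

/-- `x` has minimal length in its coset `x W_J`. -/
def IsMinRep (J : Set B) (x : W) : Prop :=
  ∀ u ∈ parabolic cs J, cs.length x ≤ cs.length (x * u)

lemma minRep_inv_mul_mem (J : Set B) (w : W) : (minRep cs J w)⁻¹ * w ∈ parabolic cs J :=
  (exists_minRep cs J w).choose_spec.1

lemma isMinRep_minRep (J : Set B) (w : W) : IsMinRep cs J (minRep cs J w) := by
  intro u hu
  refine (exists_minRep cs J w).choose_spec.2 _ ?_
  rw [mul_inv_rev, mul_assoc]
  exact mul_mem (inv_mem hu) (minRep_inv_mul_mem cs J w)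

lemma minRep_mul_parPart (J : Set B) (w : W) : minRep cs J w * parPart cs J w = w :=
  mul_inv_cancel_left _ _

section

variable {cs} {J : Set B} {x u : W}

lemma IsMinRep.exists_word (hx : IsMinRep cs J x) (hu : u ∈ parabolic cs J) :
    ∃ η : List B, (∀ j ∈ η, j ∈ J) ∧ cs.wordProd η = u ∧
      cs.length (x * u) = cs.length x + η.length := by
  obtain ⟨ω, hω, rfl⟩ := cs.exists_isReduced x
  refine Subgroup.closure_induction_right
    (p := fun u _ => ∃ η : List B, (∀ j ∈ η, j ∈ J) ∧ cs.wordProd η = u ∧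
      cs.length (cs.wordProd ω * u) = cs.length (cs.wordProd ω) + η.length) ?_ ?_ ?_ hu
  · exact ⟨[], by simp⟩
  on_goal 2 =>
    rintro u - _ ⟨j, hj, rfl⟩ ih
    rw [cs.inv_simple]
    revert ih
  on_goal 1 => rintro u - _ ⟨j, hj, rfl⟩
  all_goals
    rintro ⟨η, hη, rfl, hlen⟩
    rcases cs.length_mul_simple (cs.wordProd ω * cs.wordProd η) j with h | h
    · refine ⟨η ++ [j], ?_, ?_, ?_⟩
      · simpa [or_imp, forall_and, hj] using hη
      · simp [cs.wordProd_append]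
      · rw [← mul_assoc, h, hlen, List.length_append, List.length_singleton, add_assoc]
    · obtain ⟨k, hk, hkω⟩ := exists_eraseIdx_of_isRightDescent cs (ω := ω ++ η) (j := j) (by
        rw [CoxeterSystem.IsRightDescent, cs.wordProd_append]
        omega)
      rw [cs.wordProd_append] at hkω
      rcases lt_or_ge k ω.length with hkl | hkl
      · rw [List.eraseIdx_append_of_lt_length hkl, cs.wordProd_append] at hkω
        have hmem : cs.wordProd η * cs.simple j * (cs.wordProd η)⁻¹ ∈ parabolic cs J :=
          mul_mem (mul_mem (wordProd_mem_parabolic cs hη) (Subgroup.subset_closure ⟨j, hj, rfl⟩))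
            (inv_mem (wordProd_mem_parabolic cs hη))
        have hle := hx _ hmem
        rw [← mul_assoc, ← mul_assoc, hkω, mul_inv_cancel_right, hω.eq] at hle
        have := cs.length_wordProd_le (ω.eraseIdx k)
        rw [List.length_eraseIdx_of_lt hkl] at this
        omega
      · rw [List.eraseIdx_append_of_length_le hkl, cs.wordProd_append, mul_assoc] at hkω
        rw [List.length_append] at hk
        refine ⟨η.eraseIdx (k - ω.length), fun i hi => hη i (List.mem_of_mem_eraseIdx hi),
          (mul_left_cancel hkω).symm, ?_⟩
        rw [List.length_eraseIdx_of_lt (by omega), ← mul_assoc]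
        omega

lemma IsMinRep.length_mul (hx : IsMinRep cs J x) (hu : u ∈ parabolic cs J) :
    cs.length (x * u) = cs.length x + cs.length u := by
  obtain ⟨η, -, rfl, h⟩ := hx.exists_word hu
  have h₁ := cs.length_wordProd_le η
  have h₂ := cs.length_mul_le x (cs.wordProd η)
  omega

lemma IsMinRep.eq_one_of_mul (hx : IsMinRep cs J x) (hu : u ∈ parabolic cs J)
    (hxu : IsMinRep cs J (x * u)) : u = 1 := by
  have h₁ := hxu _ (inv_mem hu)
  rw [mul_inv_cancel_right, hx.length_mul hu] at h₁
  exact cs.length_eq_zero_iff.mp (by omega)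

lemma IsMinRep.minRep_mul (hx : IsMinRep cs J x) (hu : u ∈ parabolic cs J) :
    minRep cs J (x * u) = x := by
  have hmem : x⁻¹ * minRep cs J (x * u) ∈ parabolic cs J := by
    have := mul_mem hu (inv_mem (minRep_inv_mul_mem cs J (x * u)))
    simpa [mul_assoc] using this
  have h := hx.eq_one_of_mul hmem (by simpa using isMinRep_minRep cs J (x * u))
  exact (inv_mul_eq_one.mp h).symm

lemma IsMinRep.parPart_mul (hx : IsMinRep cs J x) (hu : u ∈ parabolic cs J) :
    parPart cs J (x * u) = u := by
  rw [parPart, hx.minRep_mul hu, inv_mul_cancel_left]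

lemma IsMinRep.exists_simple_eq_conj (hx : IsMinRep cs J x) {i : B}
    (h : x⁻¹ * cs.simple i * x ∈ parabolic cs J) :
    ∃ k : B, cs.simple k ∈ parabolic cs J ∧ cs.simple i * x = x * cs.simple k := by
  have hlen := hx.length_mul h
  have heq : x * (x⁻¹ * cs.simple i * x) = cs.simple i * x := by simp [mul_assoc]
  rw [heq] at hlen
  have hone : cs.length (x⁻¹ * cs.simple i * x) = 1 := by
    rcases cs.length_simple_mul x i with h' | h' <;> omega
  obtain ⟨k, hk⟩ := cs.length_eq_one_iff.mp hone
  exact ⟨k, hk ▸ h, by rw [← hk, heq]⟩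

/-- If `s_i x ∉ x W_J`, then `s_i` preserves minimality of `x` in its coset. -/
lemma IsMinRep.simple_mul (hx : IsMinRep cs J x) {i : B}
    (h : x⁻¹ * cs.simple i * x ∉ parabolic cs J) : IsMinRep cs J (cs.simple i * x) := by
  set y := minRep cs J (cs.simple i * x) with hy
  have hymin : IsMinRep cs J y := isMinRep_minRep cs J _
  obtain ⟨v, hv⟩ : ∃ v, v = parPart cs J (cs.simple i * x) := ⟨_, rfl⟩
  have hvJ : v ∈ parabolic cs J := hv ▸ minRep_inv_mul_mem cs J _
  have hyv : y * v = cs.simple i * x := by rw [hv, hy, minRep_mul_parPart]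
  have h₁ := hymin.length_mul hvJ
  have h₂ := hx.length_mul (inv_mem hvJ)
  have hyv' : x * v⁻¹ = cs.simple i * y := by
    rw [mul_inv_eq_iff_eq_mul, mul_assoc, hyv, cs.simple_mul_simple_cancel_left]
  rw [hyv] at h₁
  rw [hyv', cs.length_inv] at h₂
  have h₃ := cs.length_simple_mul x i
  have h₄ := cs.length_simple_mul y i
  rcases Nat.eq_zero_or_pos (cs.length v) with h₀ | h₀
  · rw [cs.length_eq_zero_iff] at h₀
    rwa [← hyv, h₀, mul_one]
  exfalso
  obtain ⟨j, rfl⟩ := cs.length_eq_one_iff.mp (show cs.length v = 1 by omega)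
  obtain ⟨ω, hω, rfl⟩ := cs.exists_isReduced x
  have hyeq : y = cs.wordProd (i :: ω) * cs.simple j := by
    rw [cs.wordProd_cons, ← hyv, cs.simple_mul_simple_cancel_right]
  obtain ⟨k, hk, hkω⟩ := exists_eraseIdx_of_isRightDescent cs (ω := i :: ω) (j := j) (by
    rw [CoxeterSystem.IsRightDescent, ← hyeq, cs.wordProd_cons]
    omega)
  cases k with
  | zero =>
    apply h
    rw [List.eraseIdx_cons_zero, cs.wordProd_cons] at hkω
    have : (cs.wordProd ω)⁻¹ * cs.simple i * cs.wordProd ω = cs.simple j := by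
      rw [mul_assoc, inv_mul_eq_iff_eq_mul]
      nth_rw 2 [← hkω]
      rw [cs.simple_mul_simple_cancel_right]
    rwa [this]
  | succ k =>
    rw [List.length_cons] at hk
    rw [List.eraseIdx_cons_succ, cs.wordProd_cons, cs.wordProd_cons, mul_assoc] at hkω
    have hle := hx _ hvJ
    rw [mul_left_cancel hkω, hω.eq] at hle
    have := cs.length_wordProd_le (ω.eraseIdx k)
    rw [List.length_eraseIdx_of_lt (by omega)] at this
    omega

lemma twistedLE.twistedLength_le {v w : W} (h : twistedLE cs J v w) :
    twistedLength cs J v ≤ twistedLength cs J w := by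
  obtain ⟨u, hu, h₁, h₂⟩ := h
  have h₃ := h₁.length_le
  have h₄ := h₂.length_le
  have h₅ := cs.length_mul_le u⁻¹ (parPart cs J v)
  rw [(isMinRep_minRep cs J v).length_mul hu] at h₃
  rw [cs.length_inv] at h₅
  unfold twistedLength
  omega

lemma twistedLE_of_bruhatLE {v w : W} (h₁ : bruhatLE cs (minRep cs J v) (minRep cs J w))
    (h₂ : bruhatLE cs (parPart cs J w) (parPart cs J v)) : twistedLE cs J v w :=
  ⟨1, one_mem _, by simpa using h₁, by simpa using h₂⟩

end

variable {cs} in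
/-- Comparison of `x a` and `s_i x a` when `s_i` fixes the coset `x W_J`. -/
lemma IsMinRep.twistedLE_of_conj_mem {J : Set B} {x a : W} {i : B} (hx : IsMinRep cs J x)
    (ha : a ∈ parabolic cs J) (h : x⁻¹ * cs.simple i * x ∈ parabolic cs J) :
    (cs.length (cs.simple i * (x * a)) = cs.length (x * a) + 1 →
      twistedLE cs J (cs.simple i * (x * a)) (x * a)) ∧
    (cs.length (cs.simple i * (x * a)) + 1 = cs.length (x * a) →
      twistedLE cs J (x * a) (cs.simple i * (x * a))) ∧
    twistedLength cs J (cs.simple i * (x * a)) ≠ twistedLength cs J (x * a) := by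
  obtain ⟨k, hk, hik⟩ := hx.exists_simple_eq_conj h
  have heq : cs.simple i * (x * a) = x * (cs.simple k * a) := by
    rw [← mul_assoc, hik, mul_assoc]
  have hka := mul_mem hk ha
  rw [heq, hx.length_mul hka, hx.length_mul ha]
  refine ⟨fun hl => ?_, fun hl => ?_, ?_⟩
  · apply twistedLE_of_bruhatLE
    · rw [hx.minRep_mul hka, hx.minRep_mul ha]
      exact bruhatLE_refl cs x
    · rw [hx.parPart_mul hka, hx.parPart_mul ha]
      exact bruhatLE_simple_mul cs (by omega)
  · apply twistedLE_of_bruhatLE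
    · rw [hx.minRep_mul hka, hx.minRep_mul ha]
      exact bruhatLE_refl cs x
    · rw [hx.parPart_mul hka, hx.parPart_mul ha]
      simpa using bruhatLE_simple_mul cs (w := cs.simple k * a) (i := k) (by
        rw [cs.simple_mul_simple_cancel_left]
        omega)
  · have := cs.length_simple_mul_ne a k
    unfold twistedLength
    rw [hx.minRep_mul hka, hx.minRep_mul ha, hx.parPart_mul hka, hx.parPart_mul ha]
    omega

variable {cs} in
/-- Comparison of `x a` and `s_i x a` when `s_i` moves the coset `x W_J`. -/
lemma IsMinRep.twistedLE_of_conj_notMem {J : Set B} {x a : W} {i : B} (hx : IsMinRep cs J x)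
    (ha : a ∈ parabolic cs J) (h : x⁻¹ * cs.simple i * x ∉ parabolic cs J) :
    (cs.length (cs.simple i * (x * a)) + 1 = cs.length (x * a) →
      twistedLE cs J (cs.simple i * (x * a)) (x * a)) ∧
    (cs.length (cs.simple i * (x * a)) = cs.length (x * a) + 1 →
      twistedLE cs J (x * a) (cs.simple i * (x * a))) ∧
    twistedLength cs J (cs.simple i * (x * a)) ≠ twistedLength cs J (x * a) := by
  have hix := hx.simple_mul h
  rw [← mul_assoc, hix.length_mul ha, hx.length_mul ha]
  refine ⟨fun hl => ?_, fun hl => ?_, ?_⟩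
  · apply twistedLE_of_bruhatLE
    · rw [hix.minRep_mul ha, hx.minRep_mul ha]
      simpa using bruhatLE_simple_mul cs (w := cs.simple i * x) (i := i) (by
        rw [cs.simple_mul_simple_cancel_left]
        omega)
    · rw [hix.parPart_mul ha, hx.parPart_mul ha]
      exact bruhatLE_refl cs a
  · apply twistedLE_of_bruhatLE
    · rw [hix.minRep_mul ha, hx.minRep_mul ha]
      exact bruhatLE_simple_mul cs (by omega)
    · rw [hix.parPart_mul ha, hx.parPart_mul ha]
      exact bruhatLE_refl cs a
  · have := cs.length_simple_mul_ne x i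
    unfold twistedLength
    rw [hix.minRep_mul ha, hx.minRep_mul ha, hix.parPart_mul ha, hx.parPart_mul ha]
    omega

/-- Let `J ⊆ I`, `i ∈ I`, `w ∈ W`. Then exactly one of
`s_i w ≤^J w` and `w ≤^J s_i w` holds. Moreover `s_i w ≤^J w` iff either
(`w⁻¹s_i w ∈ W_J` and `ℓ(s_i w) = ℓ(w) + 1`) or
(`w⁻¹s_i w ∉ W_J` and `ℓ(s_i w) = ℓ(w) - 1`). -/
theorem simple_mul_twisted (J : Set B) (i : B) (w : W) :
    Xor' (twistedLE cs J (cs.simple i * w) w) (twistedLE cs J w (cs.simple i * w)) ∧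
    (twistedLE cs J (cs.simple i * w) w ↔
      (w⁻¹ * cs.simple i * w ∈ parabolic cs J ∧
        cs.length (cs.simple i * w) = cs.length w + 1) ∨
      (w⁻¹ * cs.simple i * w ∉ parabolic cs J ∧
        cs.length (cs.simple i * w) + 1 = cs.length w)) := by
  obtain ⟨x, a, hx, ha, rfl⟩ : ∃ x a, IsMinRep cs J x ∧ a ∈ parabolic cs J ∧ x * a = w :=
    ⟨_, _, isMinRep_minRep cs J w, minRep_inv_mul_mem cs J w, minRep_mul_parPart cs J w⟩
  have hconj : (x * a)⁻¹ * cs.simple i * (x * a) ∈ parabolic cs J ↔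
      x⁻¹ * cs.simple i * x ∈ parabolic cs J := by
    rw [show (x * a)⁻¹ * cs.simple i * (x * a) = a⁻¹ * (x⁻¹ * cs.simple i * x) * a by group,
      Subgroup.mul_mem_cancel_right _ ha, Subgroup.mul_mem_cancel_left _ (inv_mem ha)]
  rw [hconj]
  have hnot : twistedLength cs J (cs.simple i * (x * a)) ≠ twistedLength cs J (x * a) →
      ¬(twistedLE cs J (cs.simple i * (x * a)) (x * a) ∧
        twistedLE cs J (x * a) (cs.simple i * (x * a))) :=
    fun hne hle => hne (le_antisymm hle.1.twistedLength_le hle.2.twistedLength_le)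
  have hlen := cs.length_simple_mul (x * a) i
  have hlen' : ¬(cs.length (cs.simple i * (x * a)) = cs.length (x * a) + 1 ∧
      cs.length (cs.simple i * (x * a)) + 1 = cs.length (x * a)) := by omega
  unfold Xor'
  by_cases h : x⁻¹ * cs.simple i * x ∈ parabolic cs J
  · obtain ⟨h₁, h₂, h₃⟩ := hx.twistedLE_of_conj_mem ha h
    have := hnot h₃
    tauto
  · obtain ⟨h₁, h₂, h₃⟩ := hx.twistedLE_of_conj_notMem ha h
    have := hnot h₃
    tauto

end TwistedTP
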